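/- Let X be a finite alphabet and Ψ = {S_j : X* → ℝ^p | j ∈ J} a family of formal power series, and suppose for some N > 0 that rank H_{Ψ,N,N} = rank H_{Ψ,N,N+1} = rank H_{Ψ,N+1,N}. Then: (1) every (2N+1)-partial representation of Ψ has dimension at least rank H_{Ψ,N,N}, and there exists a (2N+1)-partial representation of Ψ of dimension exactly rank H_{Ψ,N,N}; in particular a minimal (2N+1)-partial representation of Ψ exists; (2) every minimal (2N+1)-partial representation of Ψ has dimension rank H_{Ψ,N,N} and is reachable and observable. -/

import Mathlib

open Matrix

section PowerSeriesDefs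

variable {X J : Type*} {p n : ℕ}

/-- `A_w = A_{σ_k} ⋯ A_{σ_1}` for the word `w = σ_1 ⋯ σ_k`. -/
def wordProd {n : ℕ} (A : X → Matrix (Fin n) (Fin n) ℝ) : List X → Matrix (Fin n) (Fin n) ℝ
  | [] => 1
  | σ :: w => wordProd A w * A σ

/-- Column of the full Hankel matrix of the family `S`, indexed by `(w, j)`. -/
def hankelCol (S : J → List X → Fin p → ℝ) (w : List X) (j : J) : List X × Fin p → ℝ :=
  fun vi => S j (w ++ vi.1) vi.2

/-- Linear span of the columns of the full Hankel matrix `H_Ψ`. -/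
def fullHankelSpan (S : J → List X → Fin p → ℝ) : Submodule ℝ (List X × Fin p → ℝ) :=
  Submodule.span ℝ (Set.range fun wj : List X × J => hankelCol S wj.1 wj.2)

/-- Column of the sub-Hankel matrix `H_{Ψ,M,K}` (rows restricted to `|v| ≤ M`). -/
def hankelColTrunc (S : J → List X → Fin p → ℝ) (M : ℕ) (w : List X) (j : J) :
    {v : List X // v.length ≤ M} × Fin p → ℝ :=
  fun vi => S j (w ++ vi.1.1) vi.2

/-- `rank H_{Ψ,M,K}` : dimension of the span of the columns of the sub-Hankel matrix
whose rows are indexed by `(v,i)` with `|v| ≤ M` and whose columns are indexed by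
`(w,j)` with `|w| ≤ K`. -/
noncomputable def hankelRank (S : J → List X → Fin p → ℝ) (M K : ℕ) : ℕ :=
  Module.finrank ℝ (Submodule.span ℝ
    (Set.range fun wj : {w : List X // w.length ≤ K} × J =>
      hankelColTrunc S M wj.1.1 wj.2))

/-- `R = (ℝⁿ, {A_σ}, B, C)` is an `N`-partial representation of the family `S`. -/
def IsPartialRep (S : J → List X → Fin p → ℝ) (N : ℕ)
    (A : X → Matrix (Fin n) (Fin n) ℝ) (B : J → Fin n → ℝ)
    (C : Matrix (Fin p) (Fin n) ℝ) : Prop :=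
  ∀ (j : J) (w : List X), w.length ≤ N → S j w = C.mulVec ((wordProd A w).mulVec (B j))

/-- `R = (ℝⁿ, {A_σ}, B, C)` is a (complete) representation of the family `S`. -/
def IsRep (S : J → List X → Fin p → ℝ)
    (A : X → Matrix (Fin n) (Fin n) ℝ) (B : J → Fin n → ℝ)
    (C : Matrix (Fin p) (Fin n) ℝ) : Prop :=
  ∀ (j : J) (w : List X), S j w = C.mulVec ((wordProd A w).mulVec (B j))

/-- Reachability: the span of the vectors `A_w B_j` is the whole state space. -/
def IsReachable (A : X → Matrix (Fin n) (Fin n) ℝ) (B : J → Fin n → ℝ) : Prop :=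
  Submodule.span ℝ
    {x : Fin n → ℝ | ∃ (w : List X) (j : J), x = (wordProd A w).mulVec (B j)} = ⊤

/-- Observability: the intersection of the kernels of the maps `C A_w` is trivial. -/
def IsObservable (A : X → Matrix (Fin n) (Fin n) ℝ)
    (C : Matrix (Fin p) (Fin n) ℝ) : Prop :=
  ∀ x : Fin n → ℝ, (∀ w : List X, C.mulVec ((wordProd A w).mulVec x) = 0) → x = 0

end PowerSeriesDefs

section HankelRealization

variable {X J : Type*} {p n : ℕ}

theorem wordProd_append (A : X → Matrix (Fin n) (Fin n) ℝ) (w v : List X) :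
    wordProd A (w ++ v) = wordProd A v * wordProd A w := by
  induction w with
  | nil => simp [wordProd]
  | cons σ w ih => simp [wordProd, ih, Matrix.mul_assoc]

/-- The column space of `H_{Ψ,M,K}`. -/
def hankelSpan (S : J → List X → Fin p → ℝ) (M K : ℕ) :
    Submodule ℝ ({v : List X // v.length ≤ M} × Fin p → ℝ) :=
  Submodule.span ℝ (Set.range fun wj : {w : List X // w.length ≤ K} × J =>
    hankelColTrunc S M wj.1.1 wj.2)

theorem finrank_hankelSpan (S : J → List X → Fin p → ℝ) (M K : ℕ) :
    Module.finrank ℝ (hankelSpan S M K) = hankelRank S M K := rfl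

theorem hankelColTrunc_mem (S : J → List X → Fin p → ℝ) (M : ℕ) {K : ℕ} {w : List X}
    (hw : w.length ≤ K) (j : J) : hankelColTrunc S M w j ∈ hankelSpan S M K :=
  Submodule.subset_span ⟨(⟨w, hw⟩, j), rfl⟩

theorem hankelSpan_le_iff {S : J → List X → Fin p → ℝ} {M K : ℕ}
    {U : Submodule ℝ ({v : List X // v.length ≤ M} × Fin p → ℝ)} :
    hankelSpan S M K ≤ U ↔ ∀ (w : List X) (j : J), w.length ≤ K → hankelColTrunc S M w j ∈ U := by
  rw [hankelSpan, Submodule.span_le, Set.range_subset_iff]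
  exact ⟨fun h w j hw => h (⟨w, hw⟩, j), fun h wj => h _ _ wj.1.2⟩

theorem hankelSpan_mono_right (S : J → List X → Fin p → ℝ) (M : ℕ) {K K' : ℕ} (h : K ≤ K') :
    hankelSpan S M K ≤ hankelSpan S M K' :=
  hankelSpan_le_iff.2 fun _ j hw => hankelColTrunc_mem S M (hw.trans h) j

instance finite_words_length_le [Finite X] (M : ℕ) : Finite {v : List X // v.length ≤ M} :=
  (List.finite_length_le X M).to_subtype

/-- The truncated observability map `x ↦ (C A_v x)_{|v| ≤ M}`. -/
def observabilityMap (A : X → Matrix (Fin n) (Fin n) ℝ) (C : Matrix (Fin p) (Fin n) ℝ) (M : ℕ) :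
    (Fin n → ℝ) →ₗ[ℝ] ({v : List X // v.length ≤ M} × Fin p → ℝ) :=
  LinearMap.pi fun vi => LinearMap.proj vi.2 ∘ₗ C.mulVecLin ∘ₗ (wordProd A vi.1.1).mulVecLin

theorem observabilityMap_apply (A : X → Matrix (Fin n) (Fin n) ℝ) (C : Matrix (Fin p) (Fin n) ℝ)
    (M : ℕ) (x : Fin n → ℝ) (vi : {v : List X // v.length ≤ M} × Fin p) :
    observabilityMap A C M x vi = C.mulVec ((wordProd A vi.1.1).mulVec x) vi.2 := rfl

/-- The span of the vectors `A_w B_j`. -/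
def reachableSpan (A : X → Matrix (Fin n) (Fin n) ℝ) (B : J → Fin n → ℝ) :
    Submodule ℝ (Fin n → ℝ) :=
  Submodule.span ℝ {x : Fin n → ℝ | ∃ (w : List X) (j : J), x = (wordProd A w).mulVec (B j)}

theorem IsPartialRep.hankelSpan_le {S : J → List X → Fin p → ℝ} {L M K : ℕ}
    {A : X → Matrix (Fin n) (Fin n) ℝ} {B : J → Fin n → ℝ} {C : Matrix (Fin p) (Fin n) ℝ}
    (h : IsPartialRep S L A B C) (hL : M + K ≤ L) :
    hankelSpan S M K ≤ (reachableSpan A B).map (observabilityMap A C M) := by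
  refine hankelSpan_le_iff.2 fun w j hw =>
    ⟨(wordProd A w).mulVec (B j), Submodule.subset_span ⟨w, j, rfl⟩, ?_⟩
  ext ⟨⟨v, hv⟩, i⟩
  rw [observabilityMap_apply, hankelColTrunc,
    h j (w ++ v) (by rw [List.length_append]; omega), wordProd_append, ← Matrix.mulVec_mulVec]

section PartialRepresentation

variable {S : J → List X → Fin p → ℝ} {L M K : ℕ}
  {A : X → Matrix (Fin n) (Fin n) ℝ} {B : J → Fin n → ℝ} {C : Matrix (Fin p) (Fin n) ℝ}

theorem IsPartialRep.hankelRank_le_finrank_reachableSpan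
    (h : IsPartialRep S L A B C) (hL : M + K ≤ L) :
    hankelRank S M K ≤ Module.finrank ℝ (reachableSpan A B) :=
  (Submodule.finrank_mono (h.hankelSpan_le hL)).trans (Submodule.finrank_map_le _ _)

theorem IsPartialRep.hankelRank_le_finrank_range
    (h : IsPartialRep S L A B C) (hL : M + K ≤ L) :
    hankelRank S M K ≤ Module.finrank ℝ (LinearMap.range (observabilityMap A C M)) :=
  Submodule.finrank_mono ((h.hankelSpan_le hL).trans LinearMap.map_le_range)

theorem IsPartialRep.hankelRank_le (h : IsPartialRep S L A B C) (hL : M + K ≤ L) :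
    hankelRank S M K ≤ n := by
  simpa using (h.hankelRank_le_finrank_reachableSpan hL).trans (Submodule.finrank_le _)

theorem IsPartialRep.isReachable (h : IsPartialRep S L A B C) (hL : M + K ≤ L)
    (hn : n ≤ hankelRank S M K) : IsReachable A B := by
  refine Submodule.eq_top_of_finrank_eq (le_antisymm (Submodule.finrank_le _) ?_)
  rw [Module.finrank_fin_fun]
  exact hn.trans (h.hankelRank_le_finrank_reachableSpan hL)

theorem IsPartialRep.isObservable (h : IsPartialRep S L A B C) (hL : M + K ≤ L)
    (hn : n ≤ hankelRank S M K) : IsObservable A C := by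
  have hker : LinearMap.ker (observabilityMap A C M) = ⊥ := by
    have hr := LinearMap.finrank_range_add_finrank_ker (observabilityMap A C M)
    have hle := hn.trans (h.hankelRank_le_finrank_range hL)
    rw [Module.finrank_fin_fun] at hr
    exact Submodule.finrank_eq_zero.1 (by omega)
  intro x hx
  refine (LinearMap.ker_eq_bot'.1 hker) x ?_
  ext vi
  simp [observabilityMap_apply, hx]

end PartialRepresentation

/-- Restriction of a Hankel column to the rows `(v, i)` with `|v| ≤ M`. -/
def rowRestrict (X : Type*) (p M : ℕ) :
    ({v : List X // v.length ≤ M + 1} × Fin p → ℝ) →ₗ[ℝ]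
      ({v : List X // v.length ≤ M} × Fin p → ℝ) :=
  LinearMap.funLeft ℝ ℝ fun vi => (⟨vi.1.1, vi.1.2.trans M.le_succ⟩, vi.2)

/-- The left shift `f ↦ ((v, i) ↦ f (σv, i))` on Hankel columns. -/
def rowShift (p M : ℕ) (σ : X) :
    ({v : List X // v.length ≤ M + 1} × Fin p → ℝ) →ₗ[ℝ]
      ({v : List X // v.length ≤ M} × Fin p → ℝ) :=
  LinearMap.funLeft ℝ ℝ fun vi => (⟨σ :: vi.1.1, Nat.succ_le_succ vi.1.2⟩, vi.2)

theorem rowRestrict_hankelColTrunc (S : J → List X → Fin p → ℝ) (M : ℕ) (w : List X) (j : J) :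
    rowRestrict X p M (hankelColTrunc S (M + 1) w j) = hankelColTrunc S M w j := rfl

theorem rowShift_hankelColTrunc (S : J → List X → Fin p → ℝ) (M : ℕ) (σ : X) (w : List X) (j : J) :
    rowShift p M σ (hankelColTrunc S (M + 1) w j) = hankelColTrunc S M (w ++ [σ]) j := by
  ext vi
  simp [rowShift, hankelColTrunc, LinearMap.funLeft_apply]

theorem map_rowRestrict_hankelSpan (S : J → List X → Fin p → ℝ) (M K : ℕ) :
    (hankelSpan S (M + 1) K).map (rowRestrict X p M) = hankelSpan S M K := by
  rw [hankelSpan, Submodule.map_span, ← Set.range_comp]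
  rfl

/-- The shift operators on the column space of `H_{Ψ,M,K}` under the two rank conditions. -/
theorem exists_shift [Finite X] (S : J → List X → Fin p → ℝ) {M K : ℕ}
    (hcol : hankelRank S M K = hankelRank S M (K + 1))
    (hrow : hankelRank S M K = hankelRank S (M + 1) K) :
    ∃ a : X → hankelSpan S M K →ₗ[ℝ] hankelSpan S M K, ∀ x : hankelSpan S M K,
      ∃ y ∈ hankelSpan S (M + 1) K, rowRestrict X p M y = x ∧
        ∀ σ, (a σ x).1 = rowShift p M σ y ∧
        ∀ w j, w.length ≤ K → x.1 = hankelColTrunc S M w j →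
          (a σ x).1 = hankelColTrunc S M (w ++ [σ]) j := by
  have hspan : hankelSpan S M K = hankelSpan S M (K + 1) :=
    Submodule.eq_of_le_of_finrank_eq (hankelSpan_mono_right S M K.le_succ) hcol
  have hshift (σ : X) : ∀ y ∈ hankelSpan S (M + 1) K, rowShift p M σ y ∈ hankelSpan S M K := by
    change hankelSpan S (M + 1) K ≤ (hankelSpan S M K).comap (rowShift p M σ)
    refine hankelSpan_le_iff.2 fun w j hw => ?_
    rw [Submodule.mem_comap, rowShift_hankelColTrunc, hspan]
    exact hankelColTrunc_mem S M (by simpa using hw) j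
  have hrestrict : ∀ y ∈ hankelSpan S (M + 1) K, rowRestrict X p M y ∈ hankelSpan S M K :=
    fun y hy => map_rowRestrict_hankelSpan S M K ▸ Submodule.mem_map_of_mem hy
  let ρ := (rowRestrict X p M).restrict hrestrict
  have hsurj : Function.Surjective ρ := by
    rintro ⟨x, hx⟩
    rw [← map_rowRestrict_hankelSpan] at hx
    obtain ⟨y, hy, rfl⟩ := hx
    exact ⟨⟨y, hy⟩, rfl⟩
  have hinj : Function.Injective ρ :=
    (LinearMap.injective_iff_surjective_of_finrank_eq_finrank hrow.symm).2 hsurj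
  let e := LinearEquiv.ofBijective ρ ⟨hinj, hsurj⟩
  refine ⟨fun σ => (rowShift p M σ).restrict (hshift σ) ∘ₗ e.symm.toLinearMap, fun x =>
    ⟨e.symm x, (e.symm x).2, congrArg Subtype.val (e.apply_symm_apply x),
      fun σ => ⟨rfl, fun w j hw hx => ?_⟩⟩⟩
  have hy : e.symm x = ⟨hankelColTrunc S (M + 1) w j, hankelColTrunc_mem S _ hw j⟩ :=
    e.symm_apply_eq.2 (Subtype.ext hx)
  change rowShift p M σ (e.symm x) = _
  rw [hy, rowShift_hankelColTrunc]

theorem exists_isPartialRep_of_hankelRank_eq [Finite X] (S : J → List X → Fin p → ℝ) {M K : ℕ}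
    (hcol : hankelRank S M K = hankelRank S M (K + 1))
    (hrow : hankelRank S M K = hankelRank S (M + 1) K) :
    ∃ (A : X → Matrix (Fin (hankelRank S M K)) (Fin (hankelRank S M K)) ℝ)
      (B : J → Fin (hankelRank S M K) → ℝ)
      (C : Matrix (Fin p) (Fin (hankelRank S M K)) ℝ),
      IsPartialRep S (M + K + 1) A B C := by
  obtain ⟨a, ha⟩ := exists_shift S hcol hrow
  have e : hankelSpan S M K ≃ₗ[ℝ] (Fin (hankelRank S M K) → ℝ) :=
    LinearEquiv.ofFinrankEq _ _ (by rw [finrank_hankelSpan, Module.finrank_fin_fun])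
  let c : hankelSpan S M K →ₗ[ℝ] (Fin p → ℝ) :=
    LinearMap.funLeft ℝ ℝ (fun i => (⟨[], Nat.zero_le M⟩, i)) ∘ₗ (hankelSpan S M K).subtype
  let A (σ : X) := LinearMap.toMatrix' (e.toLinearMap ∘ₗ a σ ∘ₗ e.symm.toLinearMap)
  let B (j : J) := e ⟨hankelColTrunc S M [] j, hankelColTrunc_mem S M (Nat.zero_le K) j⟩
  let C := LinearMap.toMatrix' (c ∘ₗ e.symm.toLinearMap)
  have hA (σ : X) (x : hankelSpan S M K) : (A σ).mulVec (e x) = e (a σ x) := by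
    simp [A, LinearMap.toMatrix'_mulVec]
  have hC (x : hankelSpan S M K) : C.mulVec (e x) = c x := by
    simp [C, LinearMap.toMatrix'_mulVec]
  have hreach (w : List X) (j : J) (hw : w.length ≤ K + 1) : ∃ x : hankelSpan S M K,
      x.1 = hankelColTrunc S M w j ∧ (wordProd A w).mulVec (B j) = e x := by
    induction w using List.reverseRecOn with
    | nil => exact ⟨⟨hankelColTrunc S M [] j, hankelColTrunc_mem S M K.zero_le j⟩, rfl,
      by simp [wordProd, B]⟩
    | append_singleton w σ ih =>
      have hwK : w.length ≤ K := by simpa using hw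
      obtain ⟨x, hx, hwx⟩ := ih (hwK.trans K.le_succ)
      obtain ⟨y, -, -, hy⟩ := ha x
      refine ⟨a σ x, (hy σ).2 w j hwK hx, ?_⟩
      rw [wordProd_append, ← Matrix.mulVec_mulVec, hwx, ← hA]
      simp [wordProd]
  have hobs (v : List X) (hv : v.length ≤ M) (x : hankelSpan S M K) (i : Fin p) :
      C.mulVec ((wordProd A v).mulVec (e x)) i = x.1 (⟨v, hv⟩, i) := by
    induction v generalizing x with
    | nil => simp [wordProd, hC, c, LinearMap.funLeft_apply]
    | cons σ v ih =>
      obtain ⟨y, -, hyx, hy⟩ := ha x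
      rw [wordProd, ← Matrix.mulVec_mulVec, hA, ih (Nat.le_of_succ_le hv), (hy σ).1, ← hyx]
      rfl
  refine ⟨A, B, C, fun j w hw => ?_⟩
  obtain ⟨x, hx, hwx⟩ := hreach (w.take (K + 1)) j (List.length_take_le _ _)
  ext i
  rw [← List.take_append_drop (K + 1) w, wordProd_append, ← Matrix.mulVec_mulVec, hwx,
    hobs _ (by rw [List.length_drop]; omega), hx]
  rfl

end HankelRealization

/-- under the rank condition, (1) every `(2N+1)`-partial representation has
dimension at least `rank H_{Ψ,N,N}` and one of dimension exactly `rank H_{Ψ,N,N}`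
exists (in particular a minimal `(2N+1)`-partial representation exists); (2) every
minimal `(2N+1)`-partial representation has dimension `rank H_{Ψ,N,N}` and is
reachable and observable. -/
theorem stmt3 {X J : Type*} [Fintype X] {p : ℕ} (S : J → List X → Fin p → ℝ)
    (N : ℕ) (hN : 0 < N)
    (h1 : hankelRank S N N = hankelRank S N (N + 1))
    (h2 : hankelRank S N N = hankelRank S (N + 1) N) :
    (∀ (n : ℕ) (A : X → Matrix (Fin n) (Fin n) ℝ) (B : J → Fin n → ℝ)
       (C : Matrix (Fin p) (Fin n) ℝ),
       IsPartialRep S (2 * N + 1) A B C → hankelRank S N N ≤ n) ∧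
    (∃ (A : X → Matrix (Fin (hankelRank S N N)) (Fin (hankelRank S N N)) ℝ)
       (B : J → Fin (hankelRank S N N) → ℝ)
       (C : Matrix (Fin p) (Fin (hankelRank S N N)) ℝ),
       IsPartialRep S (2 * N + 1) A B C) ∧
    (∃ (n : ℕ) (A : X → Matrix (Fin n) (Fin n) ℝ) (B : J → Fin n → ℝ)
       (C : Matrix (Fin p) (Fin n) ℝ),
       IsPartialRep S (2 * N + 1) A B C ∧
       ∀ (n' : ℕ) (A' : X → Matrix (Fin n') (Fin n') ℝ) (B' : J → Fin n' → ℝ)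
         (C' : Matrix (Fin p) (Fin n') ℝ),
         IsPartialRep S (2 * N + 1) A' B' C' → n ≤ n') ∧
    (∀ (n : ℕ) (A : X → Matrix (Fin n) (Fin n) ℝ) (B : J → Fin n → ℝ)
       (C : Matrix (Fin p) (Fin n) ℝ),
       IsPartialRep S (2 * N + 1) A B C →
       (∀ (n' : ℕ) (A' : X → Matrix (Fin n') (Fin n') ℝ) (B' : J → Fin n' → ℝ)
          (C' : Matrix (Fin p) (Fin n') ℝ),
          IsPartialRep S (2 * N + 1) A' B' C' → n ≤ n') →
       n = hankelRank S N N ∧ IsReachable A B ∧ IsObservable A C) := by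
  have h2N : 2 * N + 1 = N + N + 1 := by omega
  have hle : N + N ≤ 2 * N + 1 := by omega
  have hex := exists_isPartialRep_of_hankelRank_eq S h1 h2
  rw [← h2N] at hex
  obtain ⟨A₀, B₀, C₀, h₀⟩ := hex
  refine ⟨fun n A B C h => h.hankelRank_le hle, ⟨A₀, B₀, C₀, h₀⟩,
    ⟨_, A₀, B₀, C₀, h₀, fun n A B C h => h.hankelRank_le hle⟩, fun n A B C h hmin => ?_⟩
  have hn := hmin _ A₀ B₀ C₀ h₀
  exact ⟨le_antisymm hn (h.hankelRank_le hle), h.isReachable hle hn, h.isObservable hle hn⟩
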